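/- Let n ≥ 3 be odd. For all choices of indices i_0, i_1, j_0, j_1 ∈ {1, …, n}, the CHSH parameter obtained from measurements {e_{i_x}, ē_{i_x}} on A and {e_{j_y}, ē_{j_y}} on B on the maximally entangled polygon state φ satisfies Tsirelson's bound: |E(e_{i_0}, e_{j_0}) + E(e_{i_0}, e_{j_1}) + E(e_{i_1}, e_{j_0}) − E(e_{i_1}, e_{j_1})| ≤ 2√2. -/

import Mathlib

open Matrix Real

noncomputable section PolygonOdd

/-- `r_n = sqrt(sec(π/n))`. -/
def rn (n : ℕ) : ℝ := Real.sqrt (1 / Real.cos (π / n))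

/-- Effects of the odd-`n` polygon model. -/
def eEff (n i : ℕ) : Fin 3 → ℝ :=
  (1 / (1 + rn n ^ 2)) • ![rn n * Real.cos (2 * π * (i : ℝ) / (n : ℝ)),
                           rn n * Real.sin (2 * π * (i : ℝ) / (n : ℝ)), 1]

/-- The unit effect. -/
def uEff : Fin 3 → ℝ := ![0, 0, 1]

/-- Correlator of the dichotomic measurements with outcome-0 effects `a`, `b`
on the maximally entangled state (the identity matrix) of two odd-`n`
polygon systems. -/
def corr (a b : Fin 3 → ℝ) : ℝ :=
  a ⬝ᵥ (1 : Matrix (Fin 3) (Fin 3) ℝ) *ᵥ b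
    + (uEff - a) ⬝ᵥ (1 : Matrix (Fin 3) (Fin 3) ℝ) *ᵥ (uEff - b)
    - a ⬝ᵥ (1 : Matrix (Fin 3) (Fin 3) ℝ) *ᵥ (uEff - b)
    - (uEff - a) ⬝ᵥ (1 : Matrix (Fin 3) (Fin 3) ℝ) *ᵥ b

/-- The correlator is the inner product of unit vectors `2e - u`. -/
lemma corr_eq (a b : Fin 3 → ℝ) :
    corr a b = (2 * a 0) * (2 * b 0) + (2 * a 1) * (2 * b 1)
      + (2 * a 2 - 1) * (2 * b 2 - 1) := by
  simp only [corr, one_mulVec, dotProduct, Fin.sum_univ_three, uEff, Pi.sub_apply]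
  simp
  ring

lemma eEff_unit (n i : ℕ) :
    (2 * eEff n i 0) ^ 2 + (2 * eEff n i 1) ^ 2 + (2 * eEff n i 2 - 1) ^ 2 = 1 := by
  have h : (1 + rn n ^ 2) ≠ 0 := by positivity
  have hc := Real.sin_sq_add_cos_sq (2 * π * (i : ℝ) / (n : ℝ))
  simp only [eEff, Pi.smul_apply, smul_eq_mul, cons_val_zero, cons_val_one, cons_val]
  generalize Real.sin (2 * π * (i : ℝ) / (n : ℝ)) = s at *
  generalize Real.cos (2 * π * (i : ℝ) / (n : ℝ)) = c at *
  generalize rn n = r at *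
  field_simp
  linear_combination (4 * r ^ 2) * hc

lemma chsh_aux (a b c d e f x y z u v w : ℝ)
    (h1 : a ^ 2 + b ^ 2 + c ^ 2 = 1) (h2 : d ^ 2 + e ^ 2 + f ^ 2 = 1)
    (h3 : x ^ 2 + y ^ 2 + z ^ 2 = 1) (h4 : u ^ 2 + v ^ 2 + w ^ 2 = 1) :
    (a * x + b * y + c * z) + (a * u + b * v + c * w) + (d * x + e * y + f * z)
      - (d * u + e * v + f * w) ≤ 2 * Real.sqrt 2 := by
  have hs : Real.sqrt 2 ^ 2 = 2 := Real.sq_sqrt (by norm_num)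
  have hp : 0 < Real.sqrt 2 := by positivity
  generalize Real.sqrt 2 = t at *
  have key : 0 ≤ (t * a - (x + u)) ^ 2 + (t * b - (y + v)) ^ 2 + (t * c - (z + w)) ^ 2
      + (t * d - (x - u)) ^ 2 + (t * e - (y - v)) ^ 2 + (t * f - (z - w)) ^ 2 := by positivity
  have e1 : (t * a - (x + u)) ^ 2 + (t * b - (y + v)) ^ 2 + (t * c - (z + w)) ^ 2
      + (t * d - (x - u)) ^ 2 + (t * e - (y - v)) ^ 2 + (t * f - (z - w)) ^ 2
      = 2 * t * (2 * t - ((a * x + b * y + c * z) + (a * u + b * v + c * w)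
        + (d * x + e * y + f * z) - (d * u + e * v + f * w))) := by
    linear_combination t ^ 2 * h1 + t ^ 2 * h2 + 2 * h3 + 2 * h4 - 2 * hs
  rw [e1] at key
  have := nonneg_of_mul_nonneg_right key (by positivity)
  linarith

/-- **Odd polygons satisfy Tsirelson's bound.**  For all choices of measurement
settings, the CHSH parameter on the maximally entangled state of two odd-`n`
polygon systems is at most `2√2`. -/
theorem odd_polygon_tsirelson (n : ℕ) (hn : 3 ≤ n) (hodd : Odd n)
    (i₀ i₁ j₀ j₁ : ℕ) (hi₀1 : 1 ≤ i₀) (hi₀n : i₀ ≤ n) (hi₁1 : 1 ≤ i₁)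
    (hi₁n : i₁ ≤ n) (hj₀1 : 1 ≤ j₀) (hj₀n : j₀ ≤ n) (hj₁1 : 1 ≤ j₁)
    (hj₁n : j₁ ≤ n) :
    |corr (eEff n i₀) (eEff n j₀) + corr (eEff n i₀) (eEff n j₁)
      + corr (eEff n i₁) (eEff n j₀) - corr (eEff n i₁) (eEff n j₁)|
      ≤ 2 * Real.sqrt 2 := by
  simp only [corr_eq]
  have h1 := eEff_unit n i₀
  have h2 := eEff_unit n i₁
  have h3 := eEff_unit n j₀
  have h4 := eEff_unit n j₁
  rw [abs_le]
  constructor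
  · have := chsh_aux _ _ _ _ _ _ _ _ _ _ _ _ ((by rw [neg_sq, neg_sq, neg_sq]; exact h1 :
      (-(2 * eEff n i₀ 0)) ^ 2 + (-(2 * eEff n i₀ 1)) ^ 2 + (-(2 * eEff n i₀ 2 - 1)) ^ 2 = 1))
      ((by rw [neg_sq, neg_sq, neg_sq]; exact h2 :
      (-(2 * eEff n i₁ 0)) ^ 2 + (-(2 * eEff n i₁ 1)) ^ 2 + (-(2 * eEff n i₁ 2 - 1)) ^ 2 = 1))
      h3 h4
    linarith
  · exact chsh_aux _ _ _ _ _ _ _ _ _ _ _ _ h1 h2 h3 h4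

end PolygonOdd
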